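/- arXiv:2002.05566 — 2 statements merged into one kernel-verified Lean document; each statement's English description precedes it below -/
import Mathlib

section
/- Any polar defective irreducible hypersurface Y ⊂ ℙᴺ of degree d > 1 is dual defective; more precisely def(Y) ≥ pdef(Y), with strict inequality if and only if dim Z > dim X + 1. -/
/-!
STATEMENT 12: Any polar defective irreducible hypersurface `Y ⊂ ℙᴺ` of degree `d > 1`
is dual defective; more precisely `def(Y) ≥ pdef(Y)`, with strict inequality if and only
if `dim Z > dim X + 1`.  Here `X = Y*` is the dual variety (projective dimension `dX`),
`Z` the closure of the image of the polar map (projective dimension `dZ`),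
`def(Y) = N − dX − 1` and `pdef(Y) = N − dZ`.  Projective dimensions are pinned down by
requiring that the corresponding affine cones have Krull dimension one more.
-/

open MvPolynomial

def zcl {σ : Type*} (S : Set (σ → ℂ)) : Set (σ → ℂ) :=
  {x | ∀ p : MvPolynomial σ ℂ, (∀ y ∈ S, eval y p = 0) → eval x p = 0}

def ZClosed {σ : Type*} (S : Set (σ → ℂ)) : Prop := zcl S = S

def ZIrr {σ : Type*} (S : Set (σ → ℂ)) : Prop :=
  S.Nonempty ∧ ∀ C₁ C₂ : Set (σ → ℂ), ZClosed C₁ → ZClosed C₂ →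
    S ⊆ C₁ ∪ C₂ → (S ⊆ C₁ ∨ S ⊆ C₂)

noncomputable def adim {σ : Type*} (S : Set (σ → ℂ)) : WithBot ℕ∞ :=
  Order.krullDim {T : Set (σ → ℂ) // ZIrr T ∧ ZClosed T ∧ T ⊆ S}

noncomputable def polarMap {N : ℕ} (F : MvPolynomial (Fin (N + 1)) ℂ)
    (x : Fin (N + 1) → ℂ) : Fin (N + 1) → ℂ :=
  fun i => eval x (pderiv i F)

theorem eval_aeval_eq_eval {K σ τ : Type*} [CommRing K] (f : τ → MvPolynomial σ K) (x : σ → K)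
    (p : MvPolynomial τ K) : eval x (aeval f p) = eval (fun i => eval x (f i)) p := by
  simpa [aeval_eq_eval] using comp_aeval_apply (aeval x) p (f := f)

theorem zcl_mono {σ : Type*} {S T : Set (σ → ℂ)} (h : S ⊆ T) : zcl S ⊆ zcl T :=
  fun _ hx p hp => hx p fun y hy => hp y (h hy)

theorem subset_zcl {σ : Type*} (S : Set (σ → ℂ)) : S ⊆ zcl S :=
  fun _ hx _ hp => hp _ hx

theorem zClosed_zcl {σ : Type*} (S : Set (σ → ℂ)) : ZClosed (zcl S) :=
  (subset_zcl _).antisymm' fun _ hx p hp => hx p fun _ hy => hy p hp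

theorem ZClosed.zcl_subset {σ : Type*} {S C : Set (σ → ℂ)} (hC : ZClosed C) (h : S ⊆ C) :
    zcl S ⊆ C :=
  (zcl_mono h).trans_eq hC

theorem ZClosed.exists_eval_ne_zero {σ : Type*} {C : Set (σ → ℂ)} (hC : ZClosed C) {x : σ → ℂ}
    (hx : x ∉ C) : ∃ p : MvPolynomial σ ℂ, (∀ y ∈ C, eval y p = 0) ∧ eval x p ≠ 0 := by
  rw [← hC] at hx
  simpa [zcl] using hx

theorem ZIrr.zcl {σ : Type*} {S : Set (σ → ℂ)} (hS : ZIrr S) : ZIrr (zcl S) :=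
  ⟨hS.1.mono (subset_zcl S), fun C₁ C₂ h₁ h₂ h =>
    (hS.2 C₁ C₂ h₁ h₂ ((subset_zcl S).trans h)).imp h₁.zcl_subset h₂.zcl_subset⟩

/-- The image of affine space under a polynomial map is irreducible. -/
theorem zIrr_range_eval {σ τ : Type*} (f : τ → MvPolynomial σ ℂ) :
    ZIrr (Set.range fun (x : σ → ℂ) i => eval x (f i)) := by
  refine ⟨Set.range_nonempty _, fun C₁ C₂ h₁ h₂ h => ?_⟩
  by_contra! hcon
  simp only [Set.not_subset] at hcon
  obtain ⟨⟨_, ⟨x, rfl⟩, hx⟩, ⟨_, ⟨y, rfl⟩, hy⟩⟩ := hcon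
  obtain ⟨p, hp, hpx⟩ := h₁.exists_eval_ne_zero hx
  obtain ⟨q, hq, hqy⟩ := h₂.exists_eval_ne_zero hy
  have hz : aeval f p * aeval f q = 0 := by
    refine MvPolynomial.funext_set (fun _ => Set.univ) (fun _ => Set.infinite_univ) fun w _ => ?_
    rw [map_mul, eval_aeval_eq_eval, eval_aeval_eq_eval, map_zero]
    rcases h ⟨w, rfl⟩ with hw | hw
    · rw [hp _ hw, zero_mul]
    · rw [hq _ hw, mul_zero]
  rcases mul_eq_zero.1 hz with h0 | h0
  · exact hpx (by rw [← eval_aeval_eq_eval, h0, map_zero])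
  · exact hqy (by rw [← eval_aeval_eq_eval, h0, map_zero])

theorem ZIrr.isPrime_vanishingIdeal {σ : Type*} {S : Set (σ → ℂ)} (hS : ZIrr S) :
    (vanishingIdeal ℂ S).IsPrime := by
  have hcl (p : MvPolynomial σ ℂ) : ZClosed {x | eval x p = 0} :=
    (subset_zcl _).antisymm' fun _ hx => hx p fun _ hy => hy
  refine ⟨fun h => ?_, fun {p q} hpq => ?_⟩
  · obtain ⟨x, hx⟩ := hS.1
    have h1 : (1 : MvPolynomial σ ℂ) ∈ vanishingIdeal ℂ S := h ▸ Submodule.mem_top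
    simpa using h1 x hx
  · refine (hS.2 _ _ (hcl p) (hcl q) fun x hx => ?_).imp (fun h x hx => ?_) (fun h x hx => ?_)
    · simpa [aeval_eq_eval] using hpq x hx
    · simpa [aeval_eq_eval] using h hx
    · simpa [aeval_eq_eval] using h hx

theorem adim_le {n : ℕ} (S : Set (Fin n → ℂ)) : adim S ≤ n := by
  have hdim : Order.krullDim (PrimeSpectrum (MvPolynomial (Fin n) ℂ))ᵒᵈ = n := by
    rw [Order.krullDim_orderDual]
    have := MvPolynomial.ringKrullDim_of_isNoetherianRing (R := ℂ) (ι := Fin n)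
    rwa [ringKrullDim_eq_zero_of_field, zero_add, Nat.card_fin] at this
  rw [← hdim]
  refine Order.krullDim_le_of_strictMono
    (fun T => OrderDual.toDual ⟨vanishingIdeal ℂ T.1, T.2.1.isPrime_vanishingIdeal⟩)
    fun T U hTU => ?_
  have hlt : T.1 ⊂ U.1 := hTU
  obtain ⟨x, hxU, hxT⟩ := Set.exists_of_ssubset hlt
  obtain ⟨p, hp, hpx⟩ := T.2.2.1.exists_eval_ne_zero hxT
  refine OrderDual.toDual_lt_toDual.2 (lt_of_le_not_ge
    (vanishingIdeal_anti_mono (k := ℂ) hlt.1) fun hle => hpx ?_)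
  have := hle (x := p) fun y hy => by simpa [aeval_eq_eval] using hp y hy
  simpa [aeval_eq_eval] using this x hxU

theorem adim_add_one_le {σ : Type*} {S Z : Set (σ → ℂ)} (hZ : ZIrr Z) (hZc : ZClosed Z)
    (hSZ : S ⊂ Z) {n : ℕ} (hn : (n : WithBot ℕ∞) ≤ adim S) :
    ((n + 1 : ℕ) : WithBot ℕ∞) ≤ adim Z := by
  obtain ⟨l, rfl⟩ := Order.le_krullDim_iff.1 hn
  let f : {T : Set (σ → ℂ) // ZIrr T ∧ ZClosed T ∧ T ⊆ S} →
      {T : Set (σ → ℂ) // ZIrr T ∧ ZClosed T ∧ T ⊆ Z} :=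
    fun T => ⟨T.1, T.2.1, T.2.2.1, T.2.2.2.trans hSZ.1⟩
  have hf : StrictMono f := fun _ _ h => h
  have hlast : (l.map f hf).last < ⟨Z, hZ, hZc, subset_rfl⟩ := by
    rw [LTSeries.last_map]
    exact l.last.2.2.2.trans_ssubset hSZ
  exact Order.le_krullDim_iff.2 ⟨(l.map f hf).snoc _ hlast, rfl⟩

/-- The chain rule for a derivation applied to a polynomial expression. -/
theorem derivation_aeval_eq_sum {k B σ : Type*} [CommRing k] [CommRing B] [Algebra k B] [Fintype σ]
    (D : Derivation k B B) (f : σ → B) (g : MvPolynomial σ k) :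
    D (aeval f g) = ∑ i, aeval f (pderiv i g) * D (f i) := by
  classical
  induction g using MvPolynomial.induction_on with
  | C a => simp [algHom_C]
  | add p q hp hq => simp [hp, hq, add_mul, Finset.sum_add_distrib]
  | mul_X p j hp =>
    simp only [map_mul, aeval_X, Derivation.leibniz, hp, smul_eq_mul, map_add, pderiv_X, add_mul,
      Finset.sum_add_distrib, Finset.mul_sum]
    congr 1
    · rw [Finset.sum_eq_single j] <;> simp +contextual
    · exact Finset.sum_congr rfl fun i _ => by ring

/-- If a derivation of a polynomial ring kills its own values on the variables, then it
exponentiates to the translation along these values, which fixes every element it kills. -/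
theorem aeval_X_sub_of_derivation_eq_zero {K σ : Type*} [Field K] [CharZero K]
    (D : Derivation K (MvPolynomial σ K) (MvPolynomial σ K)) (hD : ∀ i, D (D (X i)) = 0)
    (p : MvPolynomial σ K) (hp : D p = 0) : aeval (fun i => X i - D (X i)) p = p := by
  set T : MvPolynomial σ K →ₐ[K] Polynomial (MvPolynomial σ K) :=
    aeval fun i => Polynomial.C (X i) + Polynomial.C (D (X i)) * Polynomial.X with hT
  have hzero (p : MvPolynomial σ K) : (T p).coeff 0 = p := by
    induction p using MvPolynomial.induction_on with
    | C a => simp [algHom_C, Polynomial.algebraMap_apply]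
    | add p q hp hq => simp [hp, hq]
    | mul_X p j hp => simp [Polynomial.mul_coeff_zero, hp, show T (X j) = _ from aeval_X _ j]
  have hsucc (p : MvPolynomial σ K) :
      ∀ n : ℕ, ((n : MvPolynomial σ K) + 1) * (T p).coeff (n + 1) = D ((T p).coeff n) := by
    induction p using MvPolynomial.induction_on with
    | C a =>
      rintro (_ | n) <;>
        simp [algHom_C, Polynomial.algebraMap_apply, Polynomial.coeff_C]
    | add p q hp hq => intro n; simp [← hp, ← hq, mul_add]
    | mul_X p j hp =>
      have hX : T (X j) = Polynomial.C (X j) + Polynomial.C (D (X j)) * Polynomial.X := by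
        simp [hT]
      rintro (_ | n)
      · have h0 := hp 0
        simp only [map_mul, hX, mul_add, ← mul_assoc, Polynomial.coeff_add, Polynomial.coeff_mul_C,
          Polynomial.coeff_mul_X, Polynomial.coeff_mul_X_zero, map_add, Derivation.leibniz,
          ← h0, smul_eq_mul, map_zero]
        push_cast
        ring
      · have h0 := hp n
        have h1 := hp (n + 1)
        simp only [map_mul, hX, mul_add, ← mul_assoc, Polynomial.coeff_add, Polynomial.coeff_mul_C,
          Polynomial.coeff_mul_X, map_add, Derivation.leibniz, hD, ← h0, ← h1, smul_eq_mul]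
        push_cast
        ring
  have hcoeff : ∀ n : ℕ, (T p).coeff (n + 1) = 0 := by
    intro n
    have hD0 : D ((T p).coeff n) = 0 := by
      induction n with
      | zero => rw [hzero, hp]
      | succ n ih =>
        have h := hsucc p n
        rw [ih] at h
        have hn : (n : MvPolynomial σ K) + 1 ≠ 0 := by exact_mod_cast n.succ_ne_zero
        rw [(mul_eq_zero.1 h).resolve_left hn, map_zero]
    have h := hsucc p n
    rw [hD0] at h
    exact (mul_eq_zero.1 h).resolve_left (by exact_mod_cast n.succ_ne_zero)
  have hTp : T p = Polynomial.C p := by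
    ext1 n
    rcases n with _ | n
    · simp [hzero]
    · simp [hcoeff]
  have hcomp : aeval (fun i => X i - D (X i)) p = Polynomial.eval (-1) (T p) := by
    have : aeval (fun i => X i - D (X i)) =
        (((Polynomial.aeval (-1 : MvPolynomial σ K)).restrictScalars K).comp T) := by
      ext1 i
      simp [hT, sub_eq_add_neg]
    rw [this]
    simp [Polynomial.coe_aeval_eq_eval]
  rw [hcomp, hTp, Polynomial.eval_C]

theorem pderiv_pderiv_comm {K σ : Type*} [CommRing K] (i j : σ) (p : MvPolynomial σ K) :
    pderiv i (pderiv j p) = pderiv j (pderiv i p) := by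
  classical
  induction p using MvPolynomial.induction_on with
  | C a => simp
  | add p q hp hq => simp [hp, hq]
  | mul_X p l hp =>
    have h (a b : σ) : pderiv a ((Pi.single b 1 : σ → MvPolynomial σ K) l) = 0 := by
      by_cases hb : l = b <;> simp [hb]
    simp only [Derivation.leibniz, pderiv_X, smul_eq_mul, map_add, hp, h]
    ring

/-- **Gordan–Noether**: if `g` is an algebraic relation between the partial derivatives of `F`,
then the gradient of `F` is invariant under translation along `∇g(∇F)`. -/
theorem eval_pderiv_sub_of_aeval_pderiv_eq_zero {K σ : Type*} [Field K] [CharZero K] [Fintype σ]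
    (F g : MvPolynomial σ K) (hg : aeval (fun i => pderiv i F) g = 0) (x : σ → K) (j : σ) :
    eval (fun i => x i - eval (fun l => eval x (pderiv l F)) (pderiv i g)) (pderiv j F) =
      eval x (pderiv j F) := by
  set h : σ → MvPolynomial σ K := fun i => aeval (fun l => pderiv l F) (pderiv i g) with hh
  let D := mkDerivation K h
  have hDX (i : σ) : D (X i) = h i := mkDerivation_X K h i
  have hDF (j : σ) : D (pderiv j F) = 0 := by
    have h1 := derivation_aeval_eq_sum D X (pderiv j F)
    have h2 := derivation_aeval_eq_sum (pderiv j) (fun i => pderiv i F) g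
    rw [hg, map_zero] at h2
    simp only [aeval_X_left_apply, hDX] at h1
    rw [h1, h2]
    refine Finset.sum_congr rfl fun i _ => ?_
    rw [pderiv_pderiv_comm]
    simp only [hh]
    ring
  have hDh (i : σ) : D (D (X i)) = 0 := by
    rw [hDX, hh, derivation_aeval_eq_sum]
    simp [hDF]
  have key := congrArg (eval x) (aeval_X_sub_of_derivation_eq_zero D hDh _ (hDF j))
  rw [eval_aeval_eq_eval] at key
  simpa only [map_sub, eval_X, hDX, hh, eval_aeval_eq_eval] using key

theorem aeval_inl_add_inr {k K σ : Type*} [CommRing k] [CommRing K] [Algebra k K] [Fintype σ]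
    (z v : σ → K) (g : MvPolynomial σ k) :
    aeval (fun i => (TrivSqZeroExt.inl (z i) + TrivSqZeroExt.inr (v i) : TrivSqZeroExt K K)) g =
      TrivSqZeroExt.inl (aeval z g) +
        TrivSqZeroExt.inr (∑ i, v i * aeval z (pderiv i g)) := by
  classical
  induction g using MvPolynomial.induction_on with
  | C a => simp [algHom_C, TrivSqZeroExt.algebraMap_eq_inl']
  | add p q hp hq =>
    simp only [map_add, hp, hq, mul_add, Finset.sum_add_distrib, TrivSqZeroExt.inl_add,
      TrivSqZeroExt.inr_add]
    ring
  | mul_X p j hp =>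
    rw [map_mul, hp, aeval_X]
    ext
    · simp
    · have h (i : σ) : v i * aeval z (pderiv i (p * X j)) =
          (if i = j then v j * aeval z p else 0) + z j * (v i * aeval z (pderiv i p)) := by
        rw [Derivation.leibniz, pderiv_X]
        by_cases hij : i = j
        · subst hij
          simp
          ring
        · simp [hij, Ne.symm hij]
          ring
      simp only [h, Finset.sum_add_distrib, ← Finset.mul_sum]
      simp
      ring

/-- First-order deformations of a map to a ring `K` extend along formally smooth maps `L → K`. -/
theorem exists_ringHom_trivSqZeroExt {L K : Type*} [CommRing L] [CommRing K] [Algebra L K]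
    [Algebra.FormallySmooth L K] (ψ : L →+* TrivSqZeroExt K K)
    (hψ : ∀ x, (ψ x).fst = algebraMap L K x) :
    ∃ s : K →+* TrivSqZeroExt K K, (∀ x, (s x).fst = x) ∧ ∀ x, s (algebraMap L K x) = ψ x := by
  suffices h : ∀ (B : Type _) [CommRing B] (π : B →+* K) (φ : L →+* B),
      Function.Surjective π → IsNilpotent (RingHom.ker π) → (∀ x, π (φ x) = algebraMap L K x) →
      ∃ s : K →+* B, (∀ x, π (s x) = x) ∧ ∀ x, s (algebraMap L K x) = φ x by
    refine h (TrivSqZeroExt K K) (TrivSqZeroExt.fstHom ℤ K K).toRingHom ψ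
      (fun x => ⟨TrivSqZeroExt.inl x, by simp⟩) ⟨2, ?_⟩ hψ
    rw [Ideal.zero_eq_bot, eq_bot_iff, pow_two, Ideal.mul_le]
    intro a ha b hb
    have ha' : a.fst = 0 := ha
    have hb' : b.fst = 0 := hb
    rw [Ideal.mem_bot]
    ext <;> simp [ha', hb']
  intro B _ π φ hsurj hnil hπ
  let := φ.toAlgebra
  let π' : B →ₐ[L] K := { π with commutes' := hπ }
  let s := Algebra.FormallySmooth.liftOfSurjective (AlgHom.id L K) π' hsurj hnil
  exact ⟨s, Algebra.FormallySmooth.liftOfSurjective_apply (AlgHom.id L K) π' hsurj hnil,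
    fun x => s.commutes x⟩

/-- In characteristic zero, a tangent vector to the subvariety with generic point `z` comes from
a first-order deformation of the ambient field. -/
theorem exists_algHom_trivSqZeroExt {k K σ : Type*} [Field k] [CharZero k] [Field K] [Algebra k K]
    [Algebra.EssFiniteType k K] [Fintype σ] (z v : σ → K)
    (h : ∀ g : MvPolynomial σ k, aeval z g = 0 → ∑ i, v i * aeval z (pderiv i g) = 0) :
    ∃ s : K →ₐ[k] TrivSqZeroExt K K, (∀ x, (s x).fst = x) ∧
      ∀ i, s (z i) = TrivSqZeroExt.inl (z i) + TrivSqZeroExt.inr (v i) := by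
  let φ : MvPolynomial σ k →ₐ[k] TrivSqZeroExt K K :=
    aeval fun i => TrivSqZeroExt.inl (z i) + TrivSqZeroExt.inr (v i)
  let π : MvPolynomial σ k →ₐ[k] K := aeval z
  let A := MvPolynomial σ k ⧸ RingHom.ker π
  let ι : A →ₐ[k] K := Ideal.kerLiftAlg π
  have hι : Function.Injective ι := Ideal.kerLiftAlg_injective π
  let φ' : A →ₐ[k] TrivSqZeroExt K K := Ideal.Quotient.liftₐ _ φ fun g hg => by
    have hg' : aeval z g = 0 := hg
    change aeval _ g = 0
    rw [aeval_inl_add_inr, hg', h g hg']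
    simp
  have hφ' (g : MvPolynomial σ k) : (φ' (Ideal.Quotient.mk _ g)).fst =
      ι (Ideal.Quotient.mk _ g) := by
    change (aeval _ g : TrivSqZeroExt K K).fst = aeval z g
    rw [aeval_inl_add_inr]
    simp
  have hfst (a : A) : (φ' a).fst = ι a := by
    obtain ⟨g, rfl⟩ := Ideal.Quotient.mk_surjective a
    exact hφ' g
  have : IsDomain A := hι.isDomain ι.toRingHom
  let : Algebra A K := ι.toRingHom.toAlgebra
  have : IsScalarTower k A K := IsScalarTower.of_algebraMap_eq fun x => (ι.commutes x).symm
  have : FaithfulSMul A K := (faithfulSMul_iff_algebraMap_injective A K).2 hι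
  let L := FractionRing A
  let : Algebra L K := FractionRing.liftAlgebra A K
  have : IsScalarTower A L K := FractionRing.isScalarTower_liftAlgebra A K
  have : IsScalarTower k L K := IsScalarTower.of_algebraMap_eq fun x => by
    rw [IsScalarTower.algebraMap_apply k A L, ← IsScalarTower.algebraMap_apply A L K,
      ← IsScalarTower.algebraMap_apply k A K]
  have : CharZero L := charZero_of_injective_algebraMap (algebraMap k L).injective
  have : Algebra.EssFiniteType L K := Algebra.EssFiniteType.of_comp k L K
  have hunit (y : nonZeroDivisors A) : IsUnit (φ'.toRingHom y) := by
    rw [TrivSqZeroExt.isUnit_iff_isUnit_fst]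
    change IsUnit (φ' y).fst
    rw [hfst, isUnit_iff_ne_zero]
    exact (map_ne_zero_iff ι hι).2 (nonZeroDivisors.ne_zero y.2)
  let ψ : L →+* TrivSqZeroExt K K := IsLocalization.lift hunit
  have hψA (a : A) : ψ (algebraMap A L a) = φ' a := IsLocalization.lift_eq hunit a
  have hψ (x : L) : (ψ x).fst = algebraMap L K x := by
    have : (TrivSqZeroExt.fstHom ℤ K K).toRingHom.comp ψ = algebraMap L K := by
      refine IsLocalization.ringHom_ext (nonZeroDivisors A) (RingHom.ext fun a => ?_)
      change (ψ (algebraMap A L a)).fst = algebraMap L K (algebraMap A L a)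
      rw [hψA, hfst, ← IsScalarTower.algebraMap_apply A L K]
      rfl
    exact RingHom.congr_fun this x
  obtain ⟨s, hs, hsL⟩ := exists_ringHom_trivSqZeroExt ψ hψ
  have hsA (a : A) : s (ι a) = φ' a := by
    rw [← hψA, ← hsL, ← IsScalarTower.algebraMap_apply A L K]
    rfl
  refine ⟨{ s with commutes' := fun c => ?_ }, hs, fun i => ?_⟩
  · have := hsA (algebraMap k A c)
    rwa [ι.commutes, φ'.commutes] at this
  · have h1 := hsA (Ideal.Quotient.mk _ (X i))
    have h2 : ι (Ideal.Quotient.mk _ (X i)) = z i := aeval_X z i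
    have h3 : φ' (Ideal.Quotient.mk _ (X i)) =
      TrivSqZeroExt.inl (z i) + TrivSqZeroExt.inr (v i) := aeval_X _ i
    rwa [h2, h3] at h1

/-- The generic point of a hypersurface lies in the span of the gradients of the relations
satisfied by the polar map along the hypersurface. -/
theorem mem_span_gradient_of_aeval_eq_zero {k K σ : Type*} [Field k] [CharZero k] [Field K]
    [Algebra k K] [Algebra.EssFiniteType k K] [Fintype σ] {F : MvPolynomial σ k} {d : ℕ}
    (hF : F.IsHomogeneous d) (y : σ → K) (hy : aeval y F = 0) :
    y ∈ Submodule.span K {w : σ → K | ∃ g : MvPolynomial σ k,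
      aeval (fun i => aeval y (pderiv i F)) g = 0 ∧
        w = fun i => aeval (fun i => aeval y (pderiv i F)) (pderiv i g)} := by
  classical
  set z : σ → K := fun i => aeval y (pderiv i F) with hz
  by_contra hmem
  obtain ⟨f, hfy, hf⟩ := Submodule.exists_le_ker_of_notMem hmem
  set v : σ → K := fun i => f (Pi.single i 1) with hv
  have hfv (w : σ → K) : f w = ∑ i, v i * w i := by
    conv_lhs => rw [pi_eq_sum_univ' w]
    simp [hv, mul_comm]
  obtain ⟨s, hs, hsz⟩ := exists_algHom_trivSqZeroExt (k := k) z v fun g hg => by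
    rw [← hfv fun i => aeval z (pderiv i g)]
    exact hf (Submodule.subset_span ⟨g, hg, rfl⟩)
  have hsy (i : σ) : s (y i) = TrivSqZeroExt.inl (y i) + TrivSqZeroExt.inr (s (y i)).snd := by
    ext <;> simp [hs]
  have h1 : ∑ i, (s (y i)).snd * z i = 0 := by
    have := congrArg (fun a => (s a).snd) hy
    simp only [comp_aeval_apply, map_zero] at this
    rw [funext hsy, aeval_inl_add_inr] at this
    simpa using this
  have h2 : ∑ i, y i * z i = 0 := by
    have := congrArg (aeval y) hF.sum_X_mul_pderiv
    simpa [hy] using this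
  have h3 := congrArg (fun a => (s a).snd) h2
  simp only [map_sum, map_mul, hsz, map_zero, TrivSqZeroExt.snd_sum, TrivSqZeroExt.snd_mul,
    TrivSqZeroExt.fst_add, TrivSqZeroExt.snd_add, TrivSqZeroExt.fst_inl, TrivSqZeroExt.snd_inl,
    TrivSqZeroExt.fst_inr, TrivSqZeroExt.snd_inr, TrivSqZeroExt.snd_zero, add_zero, zero_add,
    smul_eq_mul, op_smul_eq_mul, Finset.sum_add_distrib, hs, h1] at h3
  exact hfy (by simpa only [hfv, mul_comm] using h3)

/-- A polynomial relation holds between the partial derivatives of an irreducible form modulo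
the form, but not identically: the dual variety is strictly contained in the polar image. -/
theorem exists_dvd_aeval_pderiv_and_ne_zero {k σ : Type*} [Field k] [CharZero k] [Fintype σ]
    {F : MvPolynomial σ k} {d : ℕ} (hd : 1 < d) (hirr : Irreducible F) (hF : F.IsHomogeneous d) :
    ∃ g : MvPolynomial σ k, F ∣ aeval (fun i => pderiv i F) g ∧
      aeval (fun i => pderiv i F) g ≠ 0 := by
  by_contra! hcon
  have hprime : (Ideal.span {F}).IsPrime :=
    (Ideal.span_singleton_prime hirr.ne_zero).2 hirr.prime
  let A := MvPolynomial σ k ⧸ Ideal.span {F}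
  let K := FractionRing A
  have : Algebra.EssFiniteType A K := Algebra.EssFiniteType.of_isLocalization K (nonZeroDivisors A)
  have : Algebra.EssFiniteType k K := Algebra.EssFiniteType.comp k A K
  have : CharZero K := charZero_of_injective_algebraMap (algebraMap k K).injective
  let y : σ → K := fun i => algebraMap A K (Ideal.Quotient.mk _ (X i))
  have haeval (p : MvPolynomial σ k) : aeval y p = algebraMap A K (Ideal.Quotient.mk _ p) := by
    have : aeval y = ((Algebra.ofId A K).restrictScalars k).comp
        (Ideal.Quotient.mkₐ k (Ideal.span {F})) := by
      ext i
      simp only [aeval_X, y]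
      rfl
    rw [this]
    rfl
  have hzero (p : MvPolynomial σ k) : aeval y p = 0 ↔ F ∣ p := by
    rw [haeval, map_eq_zero_iff _ (IsFractionRing.injective A K), Ideal.Quotient.eq_zero_iff_mem,
      Ideal.mem_span_singleton]
  set z : σ → K := fun i => aeval y (pderiv i F) with hz
  have heval (x : σ → K) (p : MvPolynomial σ k) :
      eval x (map (algebraMap k K) p) = aeval x p := by
    rw [eval_map, aeval_def]
  let F' : MvPolynomial σ K := map (algebraMap k K) F
  have hz' : (fun i => eval y (pderiv i F')) = z := by
    funext i
    simp only [F', pderiv_map, heval, hz]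
  let W : Submodule K (MvPolynomial σ K) :=
    LinearMap.ker (aeval (R := K) fun i => pderiv i F').toLinearMap
  let grad : MvPolynomial σ K →ₗ[K] (σ → K) :=
    LinearMap.pi fun i => (aeval (R := K) z).toLinearMap ∘ₗ (pderiv i).toLinearMap
  have hspan : y ∈ W.map grad := by
    refine Submodule.span_le.2 ?_
      (mem_span_gradient_of_aeval_eq_zero hF y ((hzero F).2 dvd_rfl))
    rintro _ ⟨g, hg, rfl⟩
    have hgF : aeval (fun i => pderiv i F) g = 0 :=
      hcon g ((hzero _).1 (by rwa [comp_aeval_apply]))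
    refine ⟨map (algebraMap k K) g, ?_, ?_⟩
    · change aeval (fun i => pderiv i F') (map (algebraMap k K) g) = 0
      have := congrArg (map (algebraMap k K)) hgF
      rw [map_zero] at this
      rw [aeval_map_algebraMap, ← this]
      have h2 := comp_aeval_apply (f := fun i => pderiv i F) (mapAlgHom (Algebra.ofId k K)) g
      simp only [F', pderiv_map]
      exact h2.symm
    · funext i
      change aeval z (pderiv i (map (algebraMap k K) g)) = _
      rw [pderiv_map, aeval_map_algebraMap]
  obtain ⟨g, hg, hgy⟩ := hspan
  have hdvd (j : σ) : F ∣ pderiv j F := by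
    rw [← hzero]
    have h := eval_pderiv_sub_of_aeval_pderiv_eq_zero F' g hg y j
    have hx : (fun i => y i - eval (fun l => eval y (pderiv l F')) (pderiv i g)) = 0 := by
      funext i
      rw [hz', ← hgy]
      simp [grad, aeval_eq_eval]
    rw [hx] at h
    simp only [F', pderiv_map, heval] at h
    rw [← h, aeval_zero]
    have hc := (hF.pderiv (i := j)).coeff_eq_zero (d := 0) (by simp; omega)
    simp [constantCoeff_eq, hc]
  have hpd (j : σ) : pderiv j F = 0 := by
    by_contra hne
    obtain ⟨q, hq⟩ := hdvd j
    have hq0 : q ≠ 0 := by rintro rfl; simp [hq] at hne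
    have h1 := totalDegree_mul_of_isDomain hirr.ne_zero hq0
    rw [← hq, (hF.pderiv (i := j)).totalDegree hne, hF.totalDegree hirr.ne_zero] at h1
    omega
  have heuler := hF.sum_X_mul_pderiv
  simp only [hpd, mul_zero, Finset.sum_const_zero] at heuler
  exact (smul_ne_zero (by omega : d ≠ 0) hirr.ne_zero) heuler.symm

theorem zcl_image_ssubset_zcl_range {N d : ℕ} (hd : 1 < d) (F : MvPolynomial (Fin (N + 1)) ℂ)
    (hirr : Irreducible F) (hF : F.IsHomogeneous d) :
    zcl (polarMap F '' {x | eval x F = 0}) ⊂ zcl (Set.range (polarMap F)) := by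
  obtain ⟨g, ⟨q, hq⟩, hg0⟩ := exists_dvd_aeval_pderiv_and_ne_zero hd hirr hF
  have heval (x : Fin (N + 1) → ℂ) :
      eval (polarMap F x) g = eval x (aeval (fun i => pderiv i F) g) :=
    (eval_aeval_eq_eval _ x g).symm
  refine ssubset_of_subset_not_subset (zcl_mono (Set.image_subset_range _ _)) fun hsub => hg0 ?_
  refine MvPolynomial.funext fun x => ?_
  rw [map_zero, ← heval]
  refine hsub (subset_zcl _ ⟨x, rfl⟩) g ?_
  rintro _ ⟨y, hy : eval y F = 0, rfl⟩
  rw [heval, hq, map_mul, hy, zero_mul]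

theorem stmt12 {N d : ℕ} (hd : 1 < d)
    (F : MvPolynomial (Fin (N + 1)) ℂ)
    (hFirr : Irreducible F) (hFhom : F.IsHomogeneous d)
    (dX dZ : ℕ)
    (hdX : adim (zcl (polarMap F '' {x | eval x F = 0})) = ((dX + 1 : ℕ) : ℕ∞))
    (hdZ : adim (zcl (Set.range (polarMap F))) = ((dZ + 1 : ℕ) : ℕ∞)) :
    (0 < N - dZ → 0 < N - 1 - dX) ∧
    (N - dZ ≤ N - 1 - dX) ∧
    (N - dZ < N - 1 - dX ↔ dX + 1 < dZ) := by
  have hZ : ZIrr (Set.range (polarMap F)) := zIrr_range_eval fun i => pderiv i F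
  have h1 := adim_add_one_le hZ.zcl (zClosed_zcl _)
    (zcl_image_ssubset_zcl_range hd F hFirr hFhom) hdX.ge
  have h2 := adim_le (zcl (Set.range (polarMap F)))
  rw [hdZ] at h1 h2
  have h1' : dX + 1 + 1 ≤ dZ + 1 := by exact_mod_cast h1
  have h2' : dZ + 1 ≤ N + 1 := by exact_mod_cast h2
  omega
end

section
/- Let Y ⊂ ℙW be an irreducible cubic hypersurface with aut¹(Ŷ) ≠ 0. Then Y is dual defective: the dual variety Y* ⊂ ℙW* has codimension at least 2. -/
/-!
STATEMENT 16: Let `Y = {F = 0} ⊂ ℙW` be an irreducible cubic hypersurface whose Lie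
algebra of infinitesimal linear automorphisms of the affine cone `Ŷ` admits a nonzero
prolongation.  Then `Y` is dual defective: the dual variety `Y* ⊂ ℙW*` has codimension
at least `2`, i.e. its affine cone `X̂` (the Zariski closure of the gradient image of
`Ŷ`) has dimension at most `N − 1` (so that `Y*` has projective dimension `≤ N − 2`).
A prolongation is a symmetric bilinear map `A : Sym²W → W` with
`F(A(y,w), y, y) = 0` — equivalently `⟨∇F(y), A(y,w)⟩ = 0` — for all smooth points
`y ∈ Ŷ` and all `w ∈ W`.
-/

open MvPolynomial

/-- A derivation vanishes when the extension is algebraic, in characteristic zero. -/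
theorem Derivation.eq_zero_of_isAlgebraic {B S : Type*} [CommRing B] [CommRing S] [IsDomain S]
    [Algebra B S] [CharZero S] [FaithfulSMul B S] [Algebra.IsAlgebraic B S]
    (D : Derivation B S S) : D = 0 := by
  ext s
  have hex : ∃ n, ∃ p : Polynomial B, p.natDegree = n ∧ p ≠ 0 ∧ Polynomial.aeval s p = 0 := by
    obtain ⟨p, hp, hs⟩ := Algebra.IsAlgebraic.isAlgebraic (R := B) s
    exact ⟨_, p, rfl, hp, hs⟩
  classical
  obtain ⟨p, hpn, hp0, hps⟩ := Nat.find_spec hex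
  have hinj : Function.Injective (algebraMap B S) := FaithfulSMul.algebraMap_injective B S
  have : IsDomain B := hinj.isDomain (algebraMap B S)
  have : CharZero B := ⟨fun m n h => by simpa using congrArg (algebraMap B S) h⟩
  have hdeg : p.natDegree ≠ 0 := by
    intro h
    obtain ⟨c, rfl⟩ := Polynomial.natDegree_eq_zero.mp h
    rw [Polynomial.aeval_C, map_eq_zero_iff _ hinj] at hps
    exact hp0 (by rw [hps, map_zero])
  have hder : Polynomial.aeval s (Polynomial.derivative p) ≠ 0 := by
    intro h
    refine Nat.find_min hex ?_ ⟨Polynomial.derivative p, rfl, ?_, h⟩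
    · rw [← hpn]; exact Polynomial.natDegree_derivative_lt hdeg
    · intro h0
      exact hdeg (Polynomial.derivative_eq_zero.mp h0)
  have h := D.map_aeval p s
  rw [hps, map_zero, smul_eq_mul] at h
  simpa using (mul_eq_zero.mp h.symm).resolve_left hder

/-- A subalgebra annihilated by a nonzero derivation has smaller transcendence degree. -/
theorem trdeg_add_one_le_of_derivation {k S : Type*} [Field k] [CharZero k] [CommRing S]
    [IsDomain S] [Algebra k S] (D : Derivation k S S) (hD : D ≠ 0) (B : Subalgebra k S)
    (hB : ∀ b ∈ B, D b = 0) : Algebra.trdeg k B + 1 ≤ Algebra.trdeg k S := by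
  have : CharZero S := charZero_of_injective_algebraMap (algebraMap k S).injective
  rw [← _root_.trdeg_add_eq k B (A := S)]
  gcongr
  rw [Cardinal.one_le_iff_ne_zero, Ne, trdeg_eq_zero_iff]
  intro halg
  let D' : Derivation B S S := Derivation.mk'
    { toFun := D
      map_add' := map_add D
      map_smul' := fun b s => by
        simp [Algebra.smul_def, hB b.1 b.2] } (fun a b => D.leibniz a b)
  have h0 : D' = 0 := D'.eq_zero_of_isAlgebraic
  exact hD (Derivation.ext fun s => congrArg (fun E : Derivation B S S => E s) h0)

theorem ringKrullDim_le_of_isIntegral {R S : Type*} [CommRing R] [CommRing S] [Algebra R S]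
    [Algebra.IsIntegral R S] : ringKrullDim S ≤ ringKrullDim R :=
  Order.krullDim_le_of_strictMono (PrimeSpectrum.comap (algebraMap R S)) fun _ _ h =>
    Ideal.IsIntegral.comap_lt_comap h

/-- The Krull dimension of a finitely generated domain over a field is at most its
transcendence degree. -/
theorem exists_ringKrullDim_le_le_trdeg (k R : Type*) [Field k] [CommRing R] [IsDomain R]
    [Algebra k R] [Algebra.FiniteType k R] :
    ∃ d : ℕ, ringKrullDim R ≤ d ∧ (d : Cardinal) ≤ Algebra.trdeg k R := by
  obtain ⟨d, g, hg, hint⟩ := exists_integral_inj_algHom_of_fg k R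
  refine ⟨d, ?_, ?_⟩
  · algebraize [g.toRingHom]
    have : Algebra.IsIntegral (MvPolynomial (Fin d) k) R := ⟨hint⟩
    refine (ringKrullDim_le_of_isIntegral (R := MvPolynomial (Fin d) k)).trans ?_
    simp
  · simpa using lift_trdeg_le_of_injective g hg

theorem trdeg_quotient_le {k : Type*} [Field k] {n : ℕ} (I : Ideal (MvPolynomial (Fin (n + 1)) k))
    [I.IsPrime] (hI : I ≠ ⊥) : Algebra.trdeg k (MvPolynomial (Fin (n + 1)) k ⧸ I) ≤ n := by
  by_contra! h
  let x : Fin (n + 1) → MvPolynomial (Fin (n + 1)) k ⧸ I := fun i => Ideal.Quotient.mk I (X i)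
  have hx : aeval x = Ideal.Quotient.mkₐ k I := by
    ext i; simp [x]
  have htop : Algebra.adjoin k (Set.range x) = ⊤ := by
    rw [Algebra.adjoin_range_eq_range_aeval, hx, AlgHom.range_eq_top]
    exact Ideal.Quotient.mkₐ_surjective k I
  have halg : Algebra.IsAlgebraic (Algebra.adjoin k (Set.range x))
      (MvPolynomial (Fin (n + 1)) k ⧸ I) := by
    refine ⟨fun s => ?_⟩
    have hs : s ∈ Algebra.adjoin k (Set.range x) := htop ▸ Algebra.mem_top
    exact isAlgebraic_algebraMap (⟨s, hs⟩ : Algebra.adjoin k (Set.range x))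
  have hbasis := Algebra.IsAlgebraic.isTranscendenceBasis_of_lift_le_trdeg_of_finite k x (by
    have := Order.succ_le_of_lt h
    simpa using this)
  refine hI (eq_bot_iff.mpr fun p hp => ?_)
  have hp0 : aeval x p = 0 := by
    rw [hx]; exact Ideal.Quotient.eq_zero_iff_mem.mpr hp
  exact (hbasis.1 (hp0.trans (map_zero _).symm))


theorem zcl_eval_eq_zero {σ : Type*} {S : Set (σ → ℂ)} {p : MvPolynomial σ ℂ}
    (hp : ∀ y ∈ S, eval y p = 0) : ∀ y ∈ zcl S, eval y p = 0 :=
  fun _ hy => hy p hp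

theorem zClosed_setOf_eval_eq_zero {σ : Type*} (p : MvPolynomial σ ℂ) :
    ZClosed {x | eval x p = 0} :=
  Set.Subset.antisymm (fun _ hx => hx p fun _ hy => hy) fun _ hx _ hq => hq _ hx

theorem mem_vanishingIdeal_iff_eval {σ : Type*} {S : Set (σ → ℂ)} {p : MvPolynomial σ ℂ} :
    p ∈ vanishingIdeal ℂ S ↔ ∀ x ∈ S, eval x p = 0 := by
  simp [aeval_eq_eval]

theorem ZClosed.subset_of_vanishingIdeal_le {σ : Type*} {S T : Set (σ → ℂ)} (hT : ZClosed T)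
    (h : vanishingIdeal ℂ T ≤ vanishingIdeal ℂ S) : S ⊆ T := fun x hx => by
  rw [← hT]
  exact fun p hp => mem_vanishingIdeal_iff_eval.mp (h (mem_vanishingIdeal_iff_eval.mpr hp)) x hx

/-- If `S` satisfies all equations in the kernel of a surjection from the polynomial ring onto `R`,
then `dim S ≤ dim R`. -/
theorem adim_le_ringKrullDim {σ R : Type*} [CommRing R] (φ : MvPolynomial σ ℂ →+* R)
    (hφ : Function.Surjective φ) (S : Set (σ → ℂ))
    (hS : ∀ p, φ p = 0 → ∀ y ∈ S, eval y p = 0) : adim S ≤ ringKrullDim R := by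
  have hker : ∀ T ⊆ S, RingHom.ker φ ≤ vanishingIdeal ℂ T := fun T hT p hp =>
    mem_vanishingIdeal_iff_eval.mpr fun y hy => hS p hp y (hT hy)
  have hcomap : ∀ T ⊆ S,
      ((vanishingIdeal ℂ T).map φ).comap φ = vanishingIdeal ℂ T := fun T hT => by
    rw [Ideal.comap_map_of_surjective φ hφ, sup_eq_left]
    exact hker T hT
  rw [adim, ringKrullDim, ← Order.krullDim_orderDual (α := PrimeSpectrum R)]
  refine Order.krullDim_le_of_strictMono (fun T => OrderDual.toDual
    (⟨(vanishingIdeal ℂ T.1).map φ,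
      have := T.2.1.isPrime_vanishingIdeal
      Ideal.map_isPrime_of_surjective hφ (hker _ T.2.2.2)⟩ : PrimeSpectrum R)) ?_
  intro T₁ T₂ h
  refine OrderDual.toDual_lt_toDual.mpr (lt_of_le_not_ge ?_ fun hle => ?_)
  · exact Ideal.map_mono (vanishingIdeal_anti_mono h.le)
  · have := Ideal.comap_mono (f := φ) hle
    rw [hcomap _ T₁.2.2.2, hcomap _ T₂.2.2.2] at this
    exact h.not_ge (T₁.2.2.1.subset_of_vanishingIdeal_le this)

theorem MvPolynomial.pderiv_comm {R σ : Type*} [CommRing R] (i j : σ) (p : MvPolynomial σ R) :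
    pderiv i (pderiv j p) = pderiv j (pderiv i p) := by
  classical
  induction p using MvPolynomial.induction_on with
  | C a => simp
  | add p q hp hq => simp [hp, hq]
  | mul_X p k hp =>
    simp only [pderiv_mul, map_add, hp, pderiv_X, Pi.single_apply, apply_ite (pderiv _),
      pderiv_one, map_zero, ite_self]
    ring

theorem MvPolynomial.mkDerivation_eq_sum {R σ : Type*} [CommRing R] [Fintype σ]
    (v : σ → MvPolynomial σ R) (p : MvPolynomial σ R) :
    mkDerivation R v p = ∑ i, v i * pderiv i p := by
  classical
  induction p using MvPolynomial.induction_on with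
  | C a => simp
  | add p q hp hq => simp [hp, hq, mul_add, Finset.sum_add_distrib]
  | mul_X p k hp =>
    simp [hp, pderiv_X, Pi.single_apply, mul_add, Finset.sum_add_distrib, Finset.mul_sum,
      mul_left_comm, mul_comm]

theorem Irreducible.dvd_of_forall_eval_eq_zero {σ k : Type*} [Finite σ] [Field k] [IsAlgClosed k]
    {F G : MvPolynomial σ k} (hF : Irreducible F) (h : ∀ y, eval y F = 0 → eval y G = 0) :
    F ∣ G := by
  have hprime : (Ideal.span {F}).IsPrime :=
    (Ideal.span_singleton_prime hF.ne_zero).mpr hF.prime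
  rw [← Ideal.mem_span_singleton, ← MvPolynomial.IsPrime.vanishingIdeal_zeroLocus (K := k) (Ideal.span {F})]
  intro y hy
  rw [aeval_eq_eval]
  refine h y ?_
  simpa [aeval_eq_eval] using hy F (Ideal.mem_span_singleton_self F)

theorem MvPolynomial.IsHomogeneous.exists_eq_C_mul {σ k : Type*} [Field k] {n : ℕ}
    {F G : MvPolynomial σ k} (hF : F.IsHomogeneous n) (hG : G.IsHomogeneous n) (hF0 : F ≠ 0)
    (h : F ∣ G) : ∃ c, G = C c * F := by
  obtain ⟨Q, rfl⟩ := h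
  rcases eq_or_ne Q 0 with rfl | hQ
  · exact ⟨0, by simp⟩
  have hdeg := totalDegree_mul_of_isDomain hF0 hQ
  rw [hG.totalDegree (mul_ne_zero hF0 hQ), hF.totalDegree hF0] at hdeg
  exact ⟨_, by rw [mul_comm, ← totalDegree_eq_zero_iff_eq_C.mp (by omega : Q.totalDegree = 0)]⟩

theorem LinearMap.eq_zero_of_forall_apply_self {V W : Type*} [AddCommGroup V] [AddCommGroup W]
    [Module ℂ V] [Module ℂ W] {A : V →ₗ[ℂ] V →ₗ[ℂ] W} (hA : ∀ u w, A u w = A w u)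
    (h : ∀ y, A y y = 0) : A = 0 := by
  ext u w
  have h2 := h (u + w)
  simp only [map_add, LinearMap.add_apply, h, hA w u, zero_add, add_zero] at h2
  rw [← two_smul ℂ] at h2
  simpa using h2

/-- The `i`-th coordinate of `y ↦ A y (e j)` as a linear form. -/
noncomputable def prolongationForm {σ : Type*} [Fintype σ] [DecidableEq σ]
    (A : (σ → ℂ) →ₗ[ℂ] (σ → ℂ) →ₗ[ℂ] (σ → ℂ)) (j i : σ) : MvPolynomial σ ℂ :=
  ∑ k, C (A (Pi.single k 1) (Pi.single j 1) i) * X k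

section prolongationForm

variable {σ : Type*} [Fintype σ] [DecidableEq σ] (A : (σ → ℂ) →ₗ[ℂ] (σ → ℂ) →ₗ[ℂ] (σ → ℂ))

theorem eval_prolongationForm (j i : σ) (y : σ → ℂ) :
    eval y (prolongationForm A j i) = A y (Pi.single j 1) i := by
  conv_rhs => rw [pi_eq_sum_univ' y]
  simp [prolongationForm, mul_comm]

theorem isHomogeneous_prolongationForm (j i : σ) : (prolongationForm A j i).IsHomogeneous 1 :=
  IsHomogeneous.sum _ _ _ fun _ _ => isHomogeneous_C_mul_X _ _

theorem pderiv_prolongationForm (k j i : σ) :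
    pderiv k (prolongationForm A j i) = C (A (Pi.single k 1) (Pi.single j 1) i) := by
  simp [prolongationForm, pderiv_X, Pi.single_apply]

theorem eval_sum_X_mul_prolongationForm (i : σ) (y : σ → ℂ) :
    eval y (∑ j, X j * prolongationForm A j i) = A y y i := by
  simp only [map_sum, map_mul, eval_X, eval_prolongationForm]
  have h := congrFun (congrArg (A y) (pi_eq_sum_univ' y)) i
  rw [h]
  simp

/-- A nonzero prolongation `A` yields a vector field tangent to the cubic cone `F = 0`, not vanishing
identically on it, along which the gradient of `F` is constant; namely `2 A(y, y) - m(y) y`, where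
`m` is the linear form with `⟨∇F(y), A(y, y)⟩ = m(y) F(y)`. -/
theorem exists_derivation_of_prolongation {F : MvPolynomial σ ℂ} (hFirr : Irreducible F)
    (hFhom : F.IsHomogeneous 3) (hA0 : A ≠ 0) (hAsymm : ∀ u w, A u w = A w u)
    (hA : ∀ y, eval y F = 0 → ∀ w, ∑ i, A y w i * eval y (pderiv i F) = 0) :
    ∃ D : Derivation ℂ (MvPolynomial σ ℂ) (MvPolynomial σ ℂ),
      F ∣ D F ∧ (∀ k, F ∣ D (pderiv k F)) ∧ ∃ i, ¬ F ∣ D (X i) := by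
  set a := prolongationForm A with ha
  have hG : ∀ j, ∃ c, ∑ i, a j i * pderiv i F = C c * F := fun j => by
    refine hFhom.exists_eq_C_mul ?_ hFirr.ne_zero (hFirr.dvd_of_forall_eval_eq_zero fun y hy => ?_)
    · exact IsHomogeneous.sum _ _ _ fun i _ =>
        (isHomogeneous_prolongationForm A j i).mul (hFhom.pderiv (i := i))
    · simpa [ha, eval_prolongationForm] using hA y hy (Pi.single j 1)
  choose μ hμ using hG
  set b : σ → MvPolynomial σ ℂ := fun i => ∑ j, X j * a j i with hb
  set m : MvPolynomial σ ℂ := ∑ j, X j * C (μ j) with hm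
  have hbF : ∑ i, b i * pderiv i F = m * F := by
    simp only [hb, hm, Finset.sum_mul]
    rw [Finset.sum_comm]
    simp only [mul_assoc, ← Finset.mul_sum, hμ]
  have euler : ∑ i, X i * pderiv i F = 3 * F := by
    rw [hFhom.sum_X_mul_pderiv, nsmul_eq_mul, Nat.cast_ofNat]
  have euler' : ∀ k, ∑ i, X i * pderiv i (pderiv k F) = 2 * pderiv k F := fun k => by
    rw [(hFhom.pderiv (i := k)).sum_X_mul_pderiv, nsmul_eq_mul, Nat.cast_sub (by omega)]; norm_num
  have hsum : ∀ k i, ∑ j, X j * C (A (Pi.single k 1) (Pi.single j 1) i) = a k i := fun k i => by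
    simp only [ha, prolongationForm, hAsymm (Pi.single k 1)]
    exact Finset.sum_congr rfl fun _ _ => mul_comm _ _
  have hbk : ∀ k, ∑ i, b i * pderiv i (pderiv k F) = m * pderiv k F - C (μ k) * F := fun k => by
    have h : ∀ j, ∑ i, C (A (Pi.single k 1) (Pi.single j 1) i) * pderiv i F +
        ∑ i, a j i * pderiv i (pderiv k F) = C (μ j) * pderiv k F := fun j => by
      have h := congrArg (pderiv k) (hμ j)
      rw [map_sum, pderiv_C_mul] at h
      rw [← h, ← Finset.sum_add_distrib]
      refine Finset.sum_congr rfl fun i _ => ?_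
      rw [pderiv_mul, ha, pderiv_prolongationForm, pderiv_comm k i]
    have h' : ∑ j, X j * (∑ i, C (A (Pi.single k 1) (Pi.single j 1) i) * pderiv i F +
        ∑ i, a j i * pderiv i (pderiv k F)) = m * pderiv k F := by
      simp only [h, hm, Finset.sum_mul, mul_assoc]
    have h₁ : ∑ j, X j * ∑ i, C (A (Pi.single k 1) (Pi.single j 1) i) * pderiv i F =
        C (μ k) * F := by
      simp only [← hμ k, ← hsum k, Finset.mul_sum, Finset.sum_mul, mul_assoc]
      exact Finset.sum_comm
    have h₂ : ∑ j, X j * ∑ i, a j i * pderiv i (pderiv k F) =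
        ∑ i, b i * pderiv i (pderiv k F) := by
      simp only [hb, Finset.mul_sum, Finset.sum_mul, mul_assoc]
      exact Finset.sum_comm
    rw [← h', ← h₁, ← h₂, eq_sub_iff_add_eq', ← Finset.sum_add_distrib]
    simp only [mul_add]
  set v : σ → MvPolynomial σ ℂ := fun i => 2 * b i - m * X i with hv
  have hvsum : ∀ p, mkDerivation ℂ v p =
      2 * ∑ i, b i * pderiv i p - m * ∑ i, X i * pderiv i p := fun p => by
    simp only [mkDerivation_eq_sum, hv, sub_mul, Finset.sum_sub_distrib, Finset.mul_sum, mul_assoc]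
  have hDF : mkDerivation ℂ v F = -m * F := by
    rw [hvsum, hbF, euler]; ring
  refine ⟨mkDerivation ℂ v, ⟨-m, by rw [hDF, mul_comm]⟩, fun k => ⟨-2 * C (μ k), ?_⟩, ?_⟩
  · rw [hvsum, hbk, euler']; ring
  by_contra! hdvd
  have hm1 : m.IsHomogeneous 1 :=
    IsHomogeneous.sum _ _ _ fun j _ => (isHomogeneous_X _ j).mul (isHomogeneous_C _ (μ j))
  have hv0 : ∀ i, v i = 0 := fun i => by
    have hvi : (v i).IsHomogeneous 2 := by
      refine IsHomogeneous.sub ?_ (hm1.mul (isHomogeneous_X _ i))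
      rw [show (2 : MvPolynomial σ ℂ) = C 2 from (map_ofNat C 2).symm]
      exact (isHomogeneous_C _ 2).mul (IsHomogeneous.sum _ _ _ fun j _ =>
        (isHomogeneous_X _ j).mul (isHomogeneous_prolongationForm A j i))
    by_contra hne
    have := totalDegree_le_of_dvd_of_isDomain (by simpa using hdvd i) hne
    rw [hFhom.totalDegree hFirr.ne_zero, hvi.totalDegree hne] at this
    omega
  have hm0 : m = 0 := by
    rw [mkDerivation_eq_sum] at hDF
    simpa [hv0, hFirr.ne_zero] using hDF
  refine hA0 (LinearMap.eq_zero_of_forall_apply_self hAsymm fun y => funext fun i => ?_)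
  have := hv0 i
  simp only [hv, hm0, zero_mul, sub_zero, mul_eq_zero, OfNat.ofNat_ne_zero, false_or] at this
  rw [← eval_sum_X_mul_prolongationForm]
  exact (congrArg (eval y) this).trans (map_zero _)

end prolongationForm

theorem stmt16 {N : ℕ}
    (F : MvPolynomial (Fin (N + 1)) ℂ)
    (hFirr : Irreducible F) (hFhom : F.IsHomogeneous 3)
    -- a nonzero prolongation of aut(Ŷ)
    (hprol : ∃ A : (Fin (N + 1) → ℂ) →ₗ[ℂ] (Fin (N + 1) → ℂ) →ₗ[ℂ] (Fin (N + 1) → ℂ),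
      A ≠ 0 ∧ (∀ u w, A u w = A w u) ∧
      ∀ y : Fin (N + 1) → ℂ, eval y F = 0 → polarMap F y ≠ 0 →
        ∀ w, (∑ i, A y w i * polarMap F y i) = 0) :
    adim (zcl (polarMap F '' {y | eval y F = 0})) ≤ ((N - 1 : ℕ) : ℕ∞) := by
  obtain ⟨A, hA0, hAsymm, hA⟩ := hprol
  obtain ⟨D, hDF, hDpderiv, i, hDX⟩ := exists_derivation_of_prolongation A hFirr hFhom hA0 hAsymm
    fun y hy w => by
      by_cases h : polarMap F y = 0
      · exact Finset.sum_eq_zero fun i _ => by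
          rw [show eval y (pderiv i F) = 0 from congrFun h i, mul_zero]
      · exact hA y hy h w
  have hprime : (Ideal.span {F}).IsPrime :=
    (Ideal.span_singleton_prime hFirr.ne_zero).mpr hFirr.prime
  let π := Ideal.Quotient.mkₐ ℂ (Ideal.span {F})
  have hπ : ∀ {p}, π p = 0 ↔ F ∣ p := fun {p} =>
    Ideal.Quotient.eq_zero_iff_mem.trans Ideal.mem_span_singleton
  have hker : ∀ p, π p = 0 → π (D p) = 0 := fun p hp => by
    obtain ⟨q, rfl⟩ := hπ.mp hp
    rw [hπ, D.leibniz]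
    exact dvd_add (dvd_mul_right _ _) (hDF.mul_left q)
  have hsurj : Function.Surjective π := Ideal.Quotient.mkₐ_surjective ℂ _
  let D' := Derivation.liftOfSurjective hsurj hker
  have hD'apply : ∀ p, D' (π p) = π (D p) := Derivation.liftOfSurjective_apply hsurj hker
  have hD' : D' ≠ 0 := fun h => hDX (hπ.mp (by rw [← hD'apply, h, Derivation.zero_apply]))
  let φ : MvPolynomial (Fin (N + 1)) ℂ →ₐ[ℂ] _ := aeval fun k => π (pderiv k F)
  have hφ : ∀ b ∈ φ.range, D' b = 0 := by
    rw [← Algebra.adjoin_range_eq_range_aeval]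
    refine D'.eqOn_adjoin (D2 := 0) ?_
    rintro _ ⟨k, rfl⟩
    exact (hD'apply _).trans (hπ.mpr (hDpderiv k))
  have : Algebra.FiniteType ℂ φ.range :=
    .of_surjective φ.rangeRestrict φ.rangeRestrict_surjective
  obtain ⟨d, hdim, htrdeg⟩ := exists_ringKrullDim_le_le_trdeg ℂ φ.range
  have hdN : d + 1 ≤ N := by
    have h : (d : Cardinal) + 1 ≤ N :=
      (add_le_add_left htrdeg 1).trans ((trdeg_add_one_le_of_derivation D' hD' φ.range hφ).trans
        (trdeg_quotient_le _ (by simpa using hFirr.ne_zero)))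
    exact_mod_cast h
  refine (adim_le_ringKrullDim φ.rangeRestrict.toRingHom φ.rangeRestrict_surjective _
    fun p hp => zcl_eval_eq_zero ?_).trans (hdim.trans ?_)
  · rintro _ ⟨y, hy, rfl⟩
    have hp' : φ p = 0 := congrArg Subtype.val hp
    have hφp : φ p = π (aeval (fun k => pderiv k F) p) := by
      rw [← comp_aeval_apply]
    obtain ⟨q, hq⟩ := hπ.mp (hφp.symm.trans hp')
    have := congrArg (eval y) hq
    rw [map_mul, show eval y F = 0 from hy, zero_mul] at this
    rw [← this, aeval_def, hom_eval₂, algebraMap_eq,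
      show (eval y).comp C = RingHom.id ℂ by ext; simp]
    rfl
  · exact_mod_cast (by omega : d ≤ N - 1)
end
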